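/- Let A be a ℤ-graded ring, M a ℤ-graded A-bimodule, and q ∈ A an invertible central element of degree 0. For n ≥ 0 let qCH_n(A; M) = M ⊗_ℤ A^{⊗_ℤ n}, and define ∂ : qCH_n(A; M) → qCH_{n-1}(A; M) on elementary tensors with homogeneous last factor a_n by ∂(m ⊗ a_1 ⊗ ⋯ ⊗ a_n) = m a_1 ⊗ a_2 ⊗ ⋯ ⊗ a_n + ∑_{i=1}^{n-1} (−1)^i m ⊗ a_1 ⊗ ⋯ ⊗ a_i a_{i+1} ⊗ ⋯ ⊗ a_n + (−1)^n q^{−|a_n|} a_n m ⊗ a_1 ⊗ ⋯ ⊗ a_{n−1}. Then ∂ is a well-defined homomorphism of abelian groups and ∂ ∘ ∂ = 0; that is, (qCH_•(A; M), ∂) is a chain complex of abelian groups. -/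

import Mathlib

open MulOpposite TensorProduct

/-- The `i`-th "multiply adjacent factors" face map on tuples: given
`a = (a_1, …, a_{n+1})` (zero-indexed as `a : Fin (n+1) → A`), `qHHFace i a` is the
tuple `(a_1, …, a_i * a_{i+1}, …, a_{n+1})` of length `n`, where the factors in
positions `i` and `i+1` (zero-indexed) have been multiplied. -/
def qHHFace {A : Type*} [Ring A] {n : ℕ} (i : Fin n) (a : Fin (n + 1) → A) :
    Fin n → A := fun j =>
  if j.val < i.val then a j.castSucc
  else if j.val = i.val then a i.castSucc * a i.succ
  else a j.succ

/-- The additive endomorphism of a ℤ-graded ring that multiplies the homogeneous elements of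
degree `k` by `q ^ (-k)`. -/
noncomputable def degreeTwist {A : Type*} [Ring A] (𝒜 : ℤ → AddSubgroup A) [GradedRing 𝒜]
    (q : Aˣ) : A →+ A :=
  (DirectSum.toAddMonoid fun k =>
    (AddMonoidHom.mulLeft ((q ^ (-k) : Aˣ) : A)).comp (𝒜 k).subtype).comp
    (DirectSum.decomposeAddEquiv 𝒜).toAddMonoidHom

theorem degreeTwist_of_mem {A : Type*} [Ring A] (𝒜 : ℤ → AddSubgroup A) [GradedRing 𝒜]
    (q : Aˣ) {k : ℤ} {a : A} (ha : a ∈ 𝒜 k) :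
    degreeTwist 𝒜 q a = ((q ^ (-k) : Aˣ) : A) * a := by
  simp [degreeTwist, DirectSum.decompose_of_mem 𝒜 ha]

theorem degreeTwist_mul {A : Type*} [Ring A] (𝒜 : ℤ → AddSubgroup A) [GradedRing 𝒜]
    (q : Aˣ) (hcentral : ∀ a : A, (q : A) * a = a * (q : A)) (a b : A) :
    degreeTwist 𝒜 q (a * b) = degreeTwist 𝒜 q a * degreeTwist 𝒜 q b := by
  induction a using DirectSum.Decomposition.inductionOn 𝒜 with
  | zero => simp
  | add x y hx hy => simp only [add_mul, map_add, hx, hy]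
  | @homogeneous k x =>
    induction b using DirectSum.Decomposition.inductionOn 𝒜 with
    | zero => simp
    | add y z hy hz => simp only [mul_add, map_add, hy, hz]
    | @homogeneous l y =>
      have hc : ((q ^ (-l) : Aˣ) : A) * x = x * ((q ^ (-l) : Aˣ) : A) :=
        (Commute.units_zpow_left (hcentral (x : A)) (-l)).eq
      rw [degreeTwist_of_mem 𝒜 q x.2, degreeTwist_of_mem 𝒜 q y.2,
        degreeTwist_of_mem 𝒜 q (SetLike.mul_mem_graded x.2 y.2), neg_add, zpow_add, Units.val_mul]
      simp only [mul_assoc]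
      rw [← mul_assoc (x : A), ← hc, mul_assoc]

/-- The `i`-th face map of the Hochschild complex whose left action is twisted by `σ`, on tuples
`(m, a_1, …, a_{n+1})`. -/
def hochschildFace {A M : Type*} [Ring A] [AddCommGroup M] [Module A M] [Module Aᵐᵒᵖ M]
    (σ : A →+ A) (n i : ℕ) (x : M × (Fin (n + 1) → A)) : M × (Fin n → A) :=
  (if i = 0 then op (x.2 0) • x.1 else if i = n + 1 then σ (x.2 (Fin.last n)) • x.1 else x.1,
    fun j => if j.val + 1 < i then x.2 j.castSucc
      else if j.val + 1 = i then x.2 j.castSucc * x.2 j.succ else x.2 j.succ)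

theorem hochschildFace_comp {A M : Type*} [Ring A] [AddCommGroup M] [Module A M] [Module Aᵐᵒᵖ M]
    [SMulCommClass A Aᵐᵒᵖ M] (σ : A →+ A) (hσ : ∀ a b, σ (a * b) = σ a * σ b) (n i j : ℕ)
    (hij : i ≤ j) (hj : j < n + 2) (x : M × (Fin (n + 2) → A)) :
    hochschildFace σ n i (hochschildFace σ (n + 1) (j + 1) x) =
      hochschildFace σ n j (hochschildFace σ (n + 1) i x) := by
  obtain ⟨m, a⟩ := x
  refine Prod.ext ?_ (funext fun l => ?_)
  · simp only [hochschildFace, Fin.val_zero, Fin.val_last, Fin.castSucc_zero, Fin.succ_last]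
    rcases Nat.eq_zero_or_pos i with rfl | hi
    · rcases Nat.eq_zero_or_pos j with rfl | hj0
      · simp [mul_smul]
      · by_cases hjn : j = n + 1
        · subst hjn
          simp [smul_comm]
        · simp [hj0, hj0.ne', hjn]
    · by_cases hjn : j = n + 1
      · subst hjn
        by_cases hin : i = n + 1
        · subst hin
          simp [hσ, mul_smul]
        · have h₁ : ¬n + 1 < i := by omega
          have h₂ : n + 1 ≠ i := Ne.symm hin
          have h₃ : i ≠ n + 2 := by omega
          simp [hi.ne', hin, h₁, h₂, h₃]
      · have h₁ : i ≠ n + 1 := by omega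
        have h₂ : i ≠ n + 2 := by omega
        have h₃ : j ≠ 0 := by omega
        simp [hi.ne', hjn, h₁, h₂, h₃]
  · simp only [hochschildFace, Fin.val_castSucc, Fin.val_succ, Fin.succ_castSucc]
    split_ifs <;> first | rfl | omega | exact mul_assoc _ _ _ | exact (mul_assoc _ _ _).symm

theorem hochschildFace_update {A M : Type*} [Ring A] [AddCommGroup M] [Module A M]
    [Module Aᵐᵒᵖ M] (σ : A →+ A) (n i : ℕ) (hi : i < n + 2) (m : M) (a : Fin (n + 1) → A)
    (k : Fin (n + 1)) :
    (∃ (u : A →ₗ[ℤ] M) (v : Fin n → A), ∀ x,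
      hochschildFace σ n i (m, Function.update a k x) = (u x, v)) ∨
    ∃ (u : M) (v : Fin n → A) (j : Fin n) (f : A →ₗ[ℤ] A), ∀ x,
      hochschildFace σ n i (m, Function.update a k x) = (u, Function.update v j (f x)) := by
  by_cases h0 : i = 0 ∧ k = 0
  · obtain ⟨rfl, rfl⟩ := h0
    refine Or.inl ⟨(AddMonoidHom.mk' (fun x => op x • m)
      fun x y => by rw [op_add, add_smul]).toIntLinearMap, fun j => a j.succ, fun x => ?_⟩
    simp [hochschildFace]
  by_cases h1 : i = n + 1 ∧ k = Fin.last n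
  · obtain ⟨rfl, rfl⟩ := h1
    refine Or.inl ⟨(AddMonoidHom.mk' (fun x => σ x • m)
      fun x y => by rw [map_add, add_smul]).toIntLinearMap, fun j => a j.castSucc, fun x => ?_⟩
    simp [hochschildFace]
  right
  have hu : ∀ x, (hochschildFace σ n i (m, Function.update a k x)).1 =
      (hochschildFace σ n i (m, a)).1 := by
    intro x
    simp only [hochschildFace]
    split_ifs with hi0 hin
    · rw [Function.update_of_ne (fun h => h0 ⟨hi0, h.symm⟩)]
    · rw [Function.update_of_ne (fun h => h1 ⟨hin, h.symm⟩)]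
    · rfl
  have hk := k.2
  have h0' : i = 0 → k.val ≠ 0 := fun h h' => h0 ⟨h, Fin.ext h'⟩
  have h1' : i = n + 1 → k.val ≠ n := fun h h' => h1 ⟨h, Fin.ext h'⟩
  rcases lt_trichotomy (k.val + 1) i with hlt | heq | hgt
  · refine ⟨_, (hochschildFace σ n i (m, a)).2, ⟨k, by omega⟩, LinearMap.id,
      fun x => Prod.ext (hu x) (funext fun j => ?_)⟩
    simp only [hochschildFace, Function.update_apply, Fin.ext_iff, Fin.val_castSucc, Fin.val_succ,
      LinearMap.id_apply]
    split_ifs <;> first | rfl | omega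
  · refine ⟨_, (hochschildFace σ n i (m, a)).2, ⟨k, by omega⟩,
      (AddMonoidHom.mulRight (a ⟨k.val + 1, by omega⟩)).toIntLinearMap,
      fun x => Prod.ext (hu x) (funext fun j => ?_)⟩
    simp only [hochschildFace, Function.update_apply, Fin.ext_iff, Fin.val_castSucc, Fin.val_succ,
      AddMonoidHom.coe_toIntLinearMap, AddMonoidHom.mulRight_apply]
    split_ifs <;> first | rfl | omega | (congr 2; ext; simp only [Fin.val_succ]; omega)
  · by_cases hki : k.val = i
    · refine ⟨_, (hochschildFace σ n i (m, a)).2, ⟨k.val - 1, by omega⟩,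
        (AddMonoidHom.mulLeft (a ⟨k.val - 1, by omega⟩)).toIntLinearMap,
        fun x => Prod.ext (hu x) (funext fun j => ?_)⟩
      simp only [hochschildFace, Function.update_apply, Fin.ext_iff, Fin.val_castSucc,
        Fin.val_succ, AddMonoidHom.coe_toIntLinearMap, AddMonoidHom.coe_mulLeft]
      split_ifs <;> first | rfl | omega | (congr 2; ext; simp only [Fin.val_castSucc]; omega)
    · refine ⟨_, (hochschildFace σ n i (m, a)).2, ⟨k.val - 1, by omega⟩, LinearMap.id,
        fun x => Prod.ext (hu x) (funext fun j => ?_)⟩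
      simp only [hochschildFace, Function.update_apply, Fin.ext_iff, Fin.val_castSucc,
        Fin.val_succ, LinearMap.id_apply]
      split_ifs <;> first | rfl | omega

/-- The `i`-th face map on `M ⊗ A^{⊗ (n+1)}`. -/
noncomputable def hochschildFaceLinear {A M : Type*} [Ring A] [AddCommGroup M] [Module A M]
    [Module Aᵐᵒᵖ M] (σ : A →+ A) (n : ℕ) (i : Fin (n + 2)) :
    (M ⊗[ℤ] TensorPower ℤ (n + 1) A) →ₗ[ℤ] (M ⊗[ℤ] TensorPower ℤ n A) :=
  TensorProduct.lift <| AddMonoidHom.toIntLinearMap <| AddMonoidHom.mk'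
    (fun m => PiTensorProduct.lift
      { toFun := fun a => (hochschildFace σ n i (m, a)).1 ⊗ₜ[ℤ]
          PiTensorProduct.tprod ℤ (hochschildFace σ n i (m, a)).2
        map_update_add' := by
          intro inst a k x y
          cases Subsingleton.elim inst (instDecidableEqFin _)
          rcases hochschildFace_update σ n i i.2 m a k with ⟨u, v, h⟩ | ⟨u, v, j, f, h⟩
          · simp [h, TensorProduct.add_tmul]
          · simp [h, TensorProduct.tmul_add]
        map_update_smul' := by
          intro inst a k c x
          cases Subsingleton.elim inst (instDecidableEqFin _)
          rcases hochschildFace_update σ n i i.2 m a k with ⟨u, v, h⟩ | ⟨u, v, j, f, h⟩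
          · simp only [h, map_smul, TensorProduct.smul_tmul']
          · simp only [h, map_smul, MultilinearMap.map_update_smul, TensorProduct.tmul_smul] })
    (fun m m' => by
      ext a
      simp only [LinearMap.compMultilinearMap_apply, PiTensorProduct.lift.tprod,
        MultilinearMap.coe_mk, LinearMap.add_apply, ← TensorProduct.add_tmul, hochschildFace]
      split_ifs <;> simp [TensorProduct.add_tmul])

theorem hochschildFaceLinear_tmul_tprod {A M : Type*} [Ring A] [AddCommGroup M] [Module A M]
    [Module Aᵐᵒᵖ M] (σ : A →+ A) (n : ℕ) (i : Fin (n + 2)) (m : M) (a : Fin (n + 1) → A) :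
    hochschildFaceLinear σ n i (m ⊗ₜ[ℤ] PiTensorProduct.tprod ℤ a) =
      (hochschildFace σ n i (m, a)).1 ⊗ₜ[ℤ]
        PiTensorProduct.tprod ℤ (hochschildFace σ n i (m, a)).2 :=
  (TensorProduct.lift.tmul _ _).trans (PiTensorProduct.lift.tprod _)

/-- A doubly indexed alternating sum vanishes if its terms satisfy the simplicial identities. -/
theorem alternating_sum_sum_eq_zero {X : Type*} [AddCommGroup X] (N : ℕ) (G : ℕ → ℕ → X)
    (hG : ∀ i j, i ≤ j → j < N → G i (j + 1) = G j i) :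
    ∑ p ∈ Finset.range N ×ˢ Finset.range (N + 1), ((-1 : ℤ) ^ (p.1 + p.2)) • G p.1 p.2 = 0 := by
  refine Finset.sum_involution
    (fun p _ => if p.1 < p.2 then (p.2 - 1, p.1) else (p.2, p.1 + 1)) ?_ ?_ ?_ ?_
  · rintro ⟨i, j⟩ hp
    simp only [Finset.mem_product, Finset.mem_range] at hp
    split_ifs with h
    · obtain ⟨j, rfl⟩ : ∃ l, j = l + 1 := ⟨j - 1, by omega⟩
      dsimp only at h ⊢
      rw [hG i j (by omega) (by omega), Nat.add_sub_cancel, ← add_smul]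
      convert zero_smul ℤ _ using 2
      ring
    · dsimp only at h ⊢
      rw [hG j i (by omega) (by omega), ← add_smul]
      convert zero_smul ℤ _ using 2
      ring
  · rintro ⟨i, j⟩ hp -
    split_ifs with h <;> simp only [ne_eq, Prod.mk.injEq] at h ⊢ <;> omega
  · rintro ⟨i, j⟩ hp
    simp only [Finset.mem_product, Finset.mem_range] at hp
    split_ifs with h <;> simp only [Finset.mem_product, Finset.mem_range] at h ⊢ <;> omega
  · rintro ⟨i, j⟩ hp
    dsimp only
    by_cases h : i < j
    · have h' : ¬j - 1 < i := by omega
      simp only [h, h', if_true, if_false, Prod.mk.injEq, true_and]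
      omega
    · have h' : j < i + 1 := by omega
      simp [h, h']

/-- The differential of the Hochschild complex whose left action is twisted by `σ`. -/
noncomputable def hochschildBoundary {A M : Type*} [Ring A] [AddCommGroup M] [Module A M]
    [Module Aᵐᵒᵖ M] (σ : A →+ A) (n : ℕ) :
    (M ⊗[ℤ] TensorPower ℤ (n + 1) A) →ₗ[ℤ] (M ⊗[ℤ] TensorPower ℤ n A) :=
  ∑ i : Fin (n + 2), ((-1 : ℤ) ^ i.val) • hochschildFaceLinear σ n i

theorem hochschildBoundary_tmul_tprod {A M : Type*} [Ring A] [AddCommGroup M] [Module A M]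
    [Module Aᵐᵒᵖ M] (σ : A →+ A) (n : ℕ) (m : M) (a : Fin (n + 1) → A) :
    hochschildBoundary σ n (m ⊗ₜ[ℤ] PiTensorProduct.tprod ℤ a) =
      (op (a 0) • m) ⊗ₜ[ℤ] PiTensorProduct.tprod ℤ (fun j : Fin n => a j.succ)
        + ∑ i : Fin n, ((-1 : ℤ) ^ (i.val + 1)) •
            (m ⊗ₜ[ℤ] PiTensorProduct.tprod ℤ (qHHFace i a))
        + ((-1 : ℤ) ^ (n + 1)) • ((σ (a (Fin.last n)) • m) ⊗ₜ[ℤ]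
            PiTensorProduct.tprod ℤ (fun j : Fin n => a j.castSucc)) := by
  have hinner : ∀ i : Fin n, hochschildFace σ n (i.val + 1) (m, a) = (m, qHHFace i a) := by
    intro i
    have hi := i.2.ne
    refine Prod.ext (by simp [hochschildFace, hi]) (funext fun j => ?_)
    simp only [hochschildFace, qHHFace, Nat.add_lt_add_iff_right, Nat.add_right_cancel_iff]
    split_ifs with _ h
    · rfl
    · rw [Fin.ext h]
    · rfl
  have hfirst : hochschildFace σ n 0 (m, a) = (op (a 0) • m, fun j => a j.succ) := by
    simp [hochschildFace]
  have hlast : hochschildFace σ n (n + 1) (m, a) =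
      (σ (a (Fin.last n)) • m, fun j => a j.castSucc) := by
    simp [hochschildFace]
  rw [hochschildBoundary, Fin.sum_univ_succ, Fin.sum_univ_castSucc]
  simp [LinearMap.sum_apply, hochschildFaceLinear_tmul_tprod, hinner, hfirst, hlast, add_assoc]

theorem hochschildBoundary_comp {A M : Type*} [Ring A] [AddCommGroup M] [Module A M]
    [Module Aᵐᵒᵖ M] [SMulCommClass A Aᵐᵒᵖ M] (σ : A →+ A)
    (hσ : ∀ a b, σ (a * b) = σ a * σ b) (n : ℕ) :
    (hochschildBoundary (M := M) σ n).comp (hochschildBoundary σ (n + 1)) = 0 := by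
  ext m a
  have h := alternating_sum_sum_eq_zero (n + 2)
    (fun i j =>
      (hochschildFace σ n i (hochschildFace σ (n + 1) j (m, a))).1 ⊗ₜ[ℤ]
        PiTensorProduct.tprod ℤ (hochschildFace σ n i (hochschildFace σ (n + 1) j (m, a))).2)
    (fun i j hij hj => by rw [hochschildFace_comp σ hσ n i j hij hj])
  rw [Finset.sum_product_right, Finset.sum_range] at h
  simp only [Finset.sum_range] at h
  change hochschildBoundary σ n (hochschildBoundary σ (n + 1)
    (m ⊗ₜ[ℤ] PiTensorProduct.tprod ℤ a)) = 0
  simpa [hochschildBoundary, LinearMap.sum_apply, hochschildFaceLinear_tmul_tprod,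
    Finset.smul_sum, smul_smul, pow_add, mul_comm] using h

theorem tmul_tprod_addHom_ext_of_homogeneous_last {A M X : Type*} [Ring A]
    (𝒜 : ℤ → AddSubgroup A) [GradedRing 𝒜] [AddCommGroup M] [AddCommGroup X] {n : ℕ}
    {f g : (M ⊗[ℤ] TensorPower ℤ (n + 1) A) →+ X}
    (h : ∀ (m : M) (a : Fin (n + 1) → A) (k : ℤ), a (Fin.last n) ∈ 𝒜 k →
      f (m ⊗ₜ[ℤ] PiTensorProduct.tprod ℤ a) = g (m ⊗ₜ[ℤ] PiTensorProduct.tprod ℤ a)) :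
    f = g := by
  suffices f.toIntLinearMap = g.toIntLinearMap from
    AddMonoidHom.ext fun x => LinearMap.congr_fun this x
  ext m a
  suffices ∀ x : A,
      f (m ⊗ₜ[ℤ] PiTensorProduct.tprod ℤ (Function.update a (Fin.last n) x)) =
        g (m ⊗ₜ[ℤ] PiTensorProduct.tprod ℤ (Function.update a (Fin.last n) x)) by
    have ha := this (a (Fin.last n))
    rwa [Function.update_eq_self] at ha
  intro x
  induction x using DirectSum.Decomposition.inductionOn 𝒜 with
  | zero => exact h m _ 0 (by simp)
  | @homogeneous k x => exact h m _ k (by simp)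
  | add x y hx hy =>
    rw [MultilinearMap.map_update_add, TensorProduct.tmul_add, map_add, map_add, hx, hy]

/-- Let `A` be a ℤ-graded ring, `M` a ℤ-graded `A`-bimodule, and `q` an invertible
central element of degree `0`.  For `n ≥ 0` let `qCH_n(A; M) = M ⊗_ℤ A^{⊗_ℤ n}`, and
define `∂ : qCH_{n+1}(A; M) → qCH_n(A; M)` on elementary tensors with homogeneous last
factor by
`∂(m ⊗ a_1 ⊗ ⋯ ⊗ a_{n+1}) = (m a_1) ⊗ a_2 ⊗ ⋯ ⊗ a_{n+1}
  + ∑_{i=1}^{n} (−1)^i m ⊗ a_1 ⊗ ⋯ ⊗ a_i a_{i+1} ⊗ ⋯ ⊗ a_{n+1}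
  + (−1)^{n+1} (q^{−|a_{n+1}|} a_{n+1} m) ⊗ a_1 ⊗ ⋯ ⊗ a_n`.
Then `∂` is a well-defined (indeed, unique) homomorphism of abelian groups and
`∂ ∘ ∂ = 0`; that is, `(qCH_•(A; M), ∂)` is a chain complex of abelian groups
(the quantum Hochschild complex of `A` with coefficients in `M` and parameter `q`). -/
theorem qHH_quantum_hochschild_complex {A : Type*} [Ring A]
    (𝒜 : ℤ → AddSubgroup A) [GradedRing 𝒜]
    {M : Type*} [AddCommGroup M] [Module A M] [Module Aᵐᵒᵖ M]
    [SMulCommClass A Aᵐᵒᵖ M]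
    (ℳ : ℤ → AddSubgroup M) [DirectSum.Decomposition ℳ]
    (hleft : ∀ (e d : ℤ), ∀ a ∈ 𝒜 e, ∀ m ∈ ℳ d, a • m ∈ ℳ (e + d))
    (hright : ∀ (d e : ℤ), ∀ m ∈ ℳ d, ∀ a ∈ 𝒜 e, op a • m ∈ ℳ (d + e))
    (q : Aˣ)
    (hcentral : ∀ a : A, (q : A) * a = a * (q : A))
    (hdeg : (q : A) ∈ 𝒜 0) :
    ∃! δ : ∀ n : ℕ, (M ⊗[ℤ] TensorPower ℤ (n + 1) A) →+ (M ⊗[ℤ] TensorPower ℤ n A),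
      (∀ (n : ℕ) (m : M) (a : Fin (n + 1) → A) (k : ℤ), a (Fin.last n) ∈ 𝒜 k →
        δ n (m ⊗ₜ[ℤ] PiTensorProduct.tprod ℤ a) =
          (op (a 0) • m) ⊗ₜ[ℤ] PiTensorProduct.tprod ℤ (fun j : Fin n => a j.succ)
          + ∑ i : Fin n, ((-1 : ℤ) ^ (i.val + 1)) •
              (m ⊗ₜ[ℤ] PiTensorProduct.tprod ℤ (qHHFace i a))
          + ((-1 : ℤ) ^ (n + 1)) •
              (((((q ^ (-k) : Aˣ) : A) * a (Fin.last n)) • m) ⊗ₜ[ℤ]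
                PiTensorProduct.tprod ℤ (fun j : Fin n => a j.castSucc))) ∧
      (∀ n : ℕ, (δ n).comp (δ (n + 1)) = 0) := by
  refine ⟨fun n => (hochschildBoundary (degreeTwist 𝒜 q) n).toAddMonoidHom, ⟨?_, ?_⟩, ?_⟩
  · intro n m a k ha
    rw [← degreeTwist_of_mem 𝒜 q ha]
    exact hochschildBoundary_tmul_tprod _ n m a
  · intro n
    ext1 x
    exact LinearMap.congr_fun
      (hochschildBoundary_comp (M := M) _ (degreeTwist_mul 𝒜 q hcentral) n) x
  · rintro δ ⟨hδ, -⟩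
    funext n
    refine tmul_tprod_addHom_ext_of_homogeneous_last 𝒜 fun m a k ha => ?_
    rw [hδ n m a k ha, ← degreeTwist_of_mem 𝒜 q ha]
    exact (hochschildBoundary_tmul_tprod _ n m a).symm
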